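/- arXiv:2504.02584 — 3 statements merged into one kernel-verified Lean document; each statement's English description precedes it below -/
import Mathlib

section
/- Assume the pair (A,A') is good. Then the linear map γ_{A,A'} : [A,A'] → A^⊥/A is bijective, and it is compatible with the induced bilinear forms: for all x, y ∈ A^⊥ ∩ A'^⊥, the induced form on A^⊥/A evaluated at (γ_{A,A'}(x + (A∩A')), γ_{A,A'}(y + (A∩A'))) equals the induced form on [A,A'] evaluated at (x + (A∩A'), y + (A∩A')). -/
open Module Submodule

variable {k V : Type*} [Field k] [AddCommGroup V] [Module k V]

/-- The orthogonal `A^⊥ = {x ∈ V : ⟨x,a⟩ = 0 ∀ a ∈ A}` of a subspace `A` of `V` with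
respect to a bilinear form `B` on `V`. -/
def perp (B : V →ₗ[k] V →ₗ[k] k) (A : Submodule k V) : Submodule k V where
  carrier := {x | ∀ a ∈ A, B x a = 0}
  add_mem' := fun {x y} hx hy a ha => by
    simp [map_add, LinearMap.add_apply, hx a ha, hy a ha]
  zero_mem' := fun a ha => by simp
  smul_mem' := fun c x hx a ha => by
    simp [map_smul, LinearMap.smul_apply, hx a ha]

/-- The pair `(A,A')` of isotropic subspaces is *good* if there is a subspace `L` with
`A^⊥ = L ⊕ A` and `A'^⊥ = L ⊕ A'` (internal direct sums). -/
def IsGood (B : V →ₗ[k] V →ₗ[k] k) (A A' : Submodule k V) : Prop :=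
  ∃ L : Submodule k V,
    (Disjoint L A ∧ L ⊔ A = perp B A) ∧ (Disjoint L A' ∧ L ⊔ A' = perp B A')

/-- The map `γ_{A,A'} : [A,A'] = (A^⊥ ∩ A'^⊥)/(A ∩ A') → A^⊥/A` induced by the inclusion
`A^⊥ ∩ A'^⊥ ⊆ A^⊥`. -/
def gammaL (B : V →ₗ[k] V →ₗ[k] k) (A A' : Submodule k V) :
    (↥(perp B A ⊓ perp B A') ⧸ (A ⊓ A').comap (perp B A ⊓ perp B A').subtype)
      →ₗ[k] (↥(perp B A) ⧸ A.comap (perp B A).subtype) :=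
  Submodule.liftQ _
    ((A.comap (perp B A).subtype).mkQ.comp (Submodule.inclusion inf_le_left))
    (by
      intro x hx
      simp only [Submodule.mem_comap, Submodule.subtype_apply, Submodule.mem_inf] at hx
      simp only [LinearMap.mem_ker, LinearMap.comp_apply, Submodule.mkQ_apply,
        Submodule.Quotient.mk_eq_zero, Submodule.mem_comap, Submodule.subtype_apply,
        Submodule.coe_inclusion]
      exact hx.1)

/-- Let `V` be a `2n`-dimensional symplectic vector space over `k` and let
`A, A'` be `t`-dimensional isotropic subspaces with `(A,A')` good.  Then the linear map
`γ_{A,A'} : [A,A'] → A^⊥/A` is bijective, and it is compatible with the induced bilinear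
forms: for all `x, y ∈ A^⊥ ∩ A'^⊥`, the induced form on `A^⊥/A` at the pair of images
`(γ_{A,A'}(x̄), γ_{A,A'}(ȳ))` equals the induced form on `[A,A']` at `(x̄, ȳ)`.
(The compatibility is expressed on representatives: if `x', y' ∈ A^⊥` represent
`γ_{A,A'}(x̄)` and `γ_{A,A'}(ȳ)` then `⟨x',y'⟩ = ⟨x,y⟩`.) -/
theorem stmt5 [FiniteDimensional k V] (n t : ℕ) (hn : 1 ≤ n) (htn : t ≤ n)
    (B : V →ₗ[k] V →ₗ[k] k)
    (hdim : finrank k V = 2 * n)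
    (halt : ∀ x : V, B x x = 0)
    (hnd : ∀ x : V, (∀ y : V, B x y = 0) → x = 0)
    (A A' : Submodule k V)
    (hA : A ≤ perp B A) (hA' : A' ≤ perp B A')
    (hdA : finrank k A = t) (hdA' : finrank k A' = t)
    (hgood : IsGood B A A') :
    Function.Bijective (gammaL B A A') ∧
    ∀ (x y : ↥(perp B A ⊓ perp B A')) (x' y' : ↥(perp B A)),
      gammaL B A A' (Submodule.Quotient.mk x) = Submodule.Quotient.mk x' →
      gammaL B A A' (Submodule.Quotient.mk y) = Submodule.Quotient.mk y' →
      B (x' : V) (y' : V) = B (x : V) (y : V) := by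
  have hanti : ∀ x y : V, B x y = - B y x := by
    intro x y
    have h := halt (x + y)
    simp only [map_add, LinearMap.add_apply, halt, zero_add, add_zero] at h
    linear_combination h
  have hsymm : ∀ x y : V, B x y = 0 → B y x = 0 := by
    intro x y h
    rw [hanti, h, neg_zero]
  have hrefl : LinearMap.IsRefl B := fun x y h => hsymm x y h
  have hperp : ∀ S : Submodule k V, perp B S = LinearMap.BilinForm.orthogonal B S := by
    intro S
    ext x
    constructor
    · intro h a ha
      exact hsymm _ _ (h a ha)
    · intro h a ha
      exact hsymm _ _ (h a ha)
  have hnd' : LinearMap.BilinForm.Nondegenerate B :=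
    ⟨hnd, fun y h => hnd y fun x => hsymm _ _ (h x)⟩
  have hpp : perp B (perp B A') = A' := by
    rw [hperp, hperp]
    exact LinearMap.BilinForm.orthogonal_orthogonal hnd' hrefl A'
  obtain ⟨L, ⟨-, hL⟩, ⟨-, hL'⟩⟩ := hgood
  have hLA : L ≤ perp B A := hL ▸ le_sup_left
  have hLA' : L ≤ perp B A' := hL' ▸ le_sup_left
  have hg : ∀ x : ↥(perp B A ⊓ perp B A'), gammaL B A A' (Submodule.Quotient.mk x)
      = Submodule.Quotient.mk (⟨x, x.2.1⟩ : ↥(perp B A)) := fun x => rfl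
  refine ⟨⟨?_, ?_⟩, ?_⟩
  · rw [injective_iff_map_eq_zero]
    intro q hq
    obtain ⟨x, rfl⟩ := Submodule.Quotient.mk_surjective _ q
    rw [hg, Submodule.Quotient.mk_eq_zero] at hq
    have hxA : (x : V) ∈ A := hq
    rw [Submodule.Quotient.mk_eq_zero]
    refine ⟨hxA, ?_⟩
    change (x : V) ∈ A'
    refine hpp.le ?_
    intro z hz
    rw [← hL'] at hz
    obtain ⟨l, hl, a, ha, rfl⟩ := Submodule.mem_sup.1 hz
    rw [map_add, hsymm _ _ (hLA hl _ hxA), x.2.2 a ha, add_zero]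
  · intro q
    obtain ⟨⟨x, hx⟩, rfl⟩ := Submodule.Quotient.mk_surjective _ q
    have hx2 := hx
    rw [← hL] at hx2
    obtain ⟨l, hl, a, ha, rfl⟩ := Submodule.mem_sup.1 hx2
    refine ⟨Submodule.Quotient.mk ⟨l, hLA hl, hLA' hl⟩, ?_⟩
    rw [hg, Submodule.Quotient.eq]
    change l - (l + a) ∈ A
    simpa using ha
  · intro x y x' y' hx hy
    rw [hg, Submodule.Quotient.eq] at hx hy
    have hx : (x : V) - x' ∈ A := hx
    have hy : (y : V) - y' ∈ A := hy
    have h1 := x'.2 _ hy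
    have h2 := hsymm _ _ (y.2.1 _ hx)
    simp only [map_sub, LinearMap.sub_apply] at h1 h2
    linear_combination -h1 - h2
end

section
/- Assume A ∩ A'^⊥ = A ∩ A'. Then the linear map γ_{A,A'} : [A,A'] → A^⊥/A is bijective. -/
open Module Submodule

variable {k V : Type*} [Field k] [AddCommGroup V] [Module k V]

/-- Let `V` be a `2n`-dimensional symplectic vector space over `k` and let
`A, A'` be `t`-dimensional isotropic subspaces.  If `A ∩ A'^⊥ = A ∩ A'` then the linear map
`γ_{A,A'} : [A,A'] → A^⊥/A` is bijective. -/
theorem stmt7 [FiniteDimensional k V] (n t : ℕ) (hn : 1 ≤ n) (htn : t ≤ n)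
    (B : V →ₗ[k] V →ₗ[k] k)
    (hdim : finrank k V = 2 * n)
    (halt : ∀ x : V, B x x = 0)
    (hnd : ∀ x : V, (∀ y : V, B x y = 0) → x = 0)
    (A A' : Submodule k V)
    (hA : A ≤ perp B A) (hA' : A' ≤ perp B A')
    (hdA : finrank k A = t) (hdA' : finrank k A' = t)
    (hyp : A ⊓ perp B A' = A ⊓ A') :
    Function.Bijective (gammaL B A A') := by
  have halt' : LinearMap.BilinForm.IsAlt B := halt
  have hrefl : LinearMap.BilinForm.IsRefl B := halt'.isRefl
  have hperp : ∀ W : Submodule k V, perp B W = LinearMap.BilinForm.orthogonal B W := by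
    intro W
    ext x
    rw [LinearMap.BilinForm.mem_orthogonal_iff]
    exact ⟨fun h a ha => hrefl _ _ (h a ha), fun h a ha => hrefl _ _ (h a ha)⟩
  have hN : LinearMap.BilinForm.Nondegenerate B :=
    ⟨hnd, fun y hy => hnd y fun x => hrefl _ _ (hy x)⟩
  have hfr : ∀ W : Submodule k V, finrank k W + finrank k (perp B W) = 2 * n := by
    intro W
    have h1 := LinearMap.BilinForm.finrank_orthogonal hN W
    have h2 := Submodule.finrank_le W
    rw [hperp]
    omega
  have hsup : perp B (A ⊔ A') = perp B A ⊓ perp B A' := by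
    ext x
    constructor
    · intro h
      exact ⟨fun a ha => h a (Submodule.mem_sup_left ha),
        fun a ha => h a (Submodule.mem_sup_right ha)⟩
    · rintro ⟨h1, h2⟩ a ha
      obtain ⟨y, hy, z, hz, rfl⟩ := Submodule.mem_sup.1 ha
      rw [map_add, h1 y hy, h2 z hz, add_zero]
  have hinf : A ⊓ (perp B A ⊓ perp B A') = A ⊓ A' := by
    rw [← inf_assoc, inf_eq_left.2 hA, hyp]
  have hkey : A ⊔ (perp B A ⊓ perp B A') = perp B A := by
    apply Submodule.eq_of_le_of_finrank_eq (sup_le hA inf_le_left)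
    have h1 := Submodule.finrank_sup_add_finrank_inf_eq A (perp B A ⊓ perp B A')
    have h2 := Submodule.finrank_sup_add_finrank_inf_eq A A'
    have h3 := hfr (A ⊔ A')
    have h4 := hfr A
    rw [hinf] at h1
    rw [hsup] at h3
    omega
  constructor
  · rw [← LinearMap.ker_eq_bot, LinearMap.ker_eq_bot']
    intro m hm
    obtain ⟨x, rfl⟩ := Submodule.Quotient.mk_surjective _ m
    have hx : (x : V) ∈ A :=
      (Submodule.Quotient.mk_eq_zero (A.comap (perp B A).subtype)
        (x := Submodule.inclusion inf_le_left x)).1 hm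
    refine (Submodule.Quotient.mk_eq_zero _).2 ?_
    have : (x : V) ∈ A ⊓ (perp B A ⊓ perp B A') := ⟨hx, x.2⟩
    rw [hinf] at this
    exact this
  · intro m
    obtain ⟨x, rfl⟩ := Submodule.Quotient.mk_surjective _ m
    have hx : (x : V) ∈ A ⊔ (perp B A ⊓ perp B A') := hkey.symm ▸ x.2
    obtain ⟨a, ha, y, hy, hxy⟩ := Submodule.mem_sup.1 hx
    refine ⟨Submodule.Quotient.mk ⟨y, hy⟩, ?_⟩
    refine (Submodule.Quotient.eq _).2 ?_
    change y - (x : V) ∈ A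
    rw [← hxy]
    have : y - (a + y) = -a := by abel
    rw [this]
    exact A.neg_mem ha
end

section
/- Assume the pair (A,A') is good. Then there exists a unique linear isomorphism ψ^A_{A'} : A^⊥/A → A'^⊥/A' such that ψ^A_{A'} ∘ γ_{A,A'} = γ_{A',A}; this isomorphism is compatible with the bilinear forms induced by ⟨·,·⟩ on A^⊥/A and on A'^⊥/A', and moreover ψ^{A'}_A ∘ ψ^A_{A'} is the identity of A^⊥/A (where ψ^{A'}_A : A'^⊥/A' → A^⊥/A is the unique linear isomorphism with ψ^{A'}_A ∘ γ_{A',A} = γ_{A,A'}). -/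
open Module Submodule

variable {k V : Type*} [Field k] [AddCommGroup V] [Module k V]

/-- The map `γ_{A',A} : [A,A'] = (A^⊥ ∩ A'^⊥)/(A ∩ A') → A'^⊥/A'` induced by the inclusion
`A^⊥ ∩ A'^⊥ ⊆ A'^⊥`. -/
def gammaR (B : V →ₗ[k] V →ₗ[k] k) (A A' : Submodule k V) :
    (↥(perp B A ⊓ perp B A') ⧸ (A ⊓ A').comap (perp B A ⊓ perp B A').subtype)
      →ₗ[k] (↥(perp B A') ⧸ A'.comap (perp B A').subtype) :=
  Submodule.liftQ _
    ((A'.comap (perp B A').subtype).mkQ.comp (Submodule.inclusion inf_le_right))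
    (by
      intro x hx
      simp only [Submodule.mem_comap, Submodule.subtype_apply, Submodule.mem_inf] at hx
      simp only [LinearMap.mem_ker, LinearMap.comp_apply, Submodule.mkQ_apply,
        Submodule.Quotient.mk_eq_zero, Submodule.mem_comap, Submodule.subtype_apply,
        Submodule.coe_inclusion]
      exact hx.2)

theorem aux_perp_perp [FiniteDimensional k V] (B : V →ₗ[k] V →ₗ[k] k)
    (halt : ∀ x : V, B x x = 0)
    (hnd : ∀ x : V, (∀ y : V, B x y = 0) → x = 0) (A : Submodule k V) :
    perp B (perp B A) ≤ A := by
  have ha : LinearMap.IsAlt B := halt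
  have hr : LinearMap.IsRefl B := ha.isRefl
  have hn : LinearMap.BilinForm.Nondegenerate B := by
    refine ⟨fun x hx => hnd x hx, fun x hx => hnd x fun y => hr _ _ (hx y)⟩
  have key : ∀ C : Submodule k V, perp B C = LinearMap.BilinForm.orthogonal B C := by
    intro C
    ext x
    exact ⟨fun h c hc => hr _ _ (h c hc), fun h c hc => hr _ _ (h c hc)⟩
  rw [key, key, LinearMap.BilinForm.orthogonal_orthogonal hn hr]

theorem aux_inter [FiniteDimensional k V] (B : V →ₗ[k] V →ₗ[k] k)
    (halt : ∀ x : V, B x x = 0)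
    (hnd : ∀ x : V, (∀ y : V, B x y = 0) → x = 0) (A A' L : Submodule k V)
    (h1 : L ⊔ A = perp B A) (h2 : L ⊔ A' = perp B A') (x : V) (hx : x ∈ A)
    (hx' : x ∈ perp B A') : x ∈ A' := by
  have hr : LinearMap.IsRefl B := LinearMap.IsAlt.isRefl halt
  apply aux_perp_perp B halt hnd A'
  intro y hy
  rw [← h2] at hy
  obtain ⟨l, hl, a, ha, rfl⟩ := Submodule.mem_sup.1 hy
  have hlA : l ∈ perp B A := h1 ▸ Submodule.mem_sup_left hl
  rw [map_add, hx' a ha, hr _ _ (hlA x hx), add_zero]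

/-- Let `V` be a `2n`-dimensional symplectic vector space over `k` and let
`A, A'` be `t`-dimensional isotropic subspaces with `(A,A')` good.  Then there is a unique
linear isomorphism `ψ^A_{A'} : A^⊥/A → A'^⊥/A'` with `ψ^A_{A'} ∘ γ_{A,A'} = γ_{A',A}`;
it is compatible with the induced bilinear forms (expressed on representatives), and
`ψ^{A'}_A ∘ ψ^A_{A'} = id`, where `ψ^{A'}_A` is the unique linear isomorphism with
`ψ^{A'}_A ∘ γ_{A',A} = γ_{A,A'}`. -/
theorem stmt10 [FiniteDimensional k V] (n t : ℕ) (hn : 1 ≤ n) (htn : t ≤ n)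
    (B : V →ₗ[k] V →ₗ[k] k)
    (hdim : finrank k V = 2 * n)
    (halt : ∀ x : V, B x x = 0)
    (hnd : ∀ x : V, (∀ y : V, B x y = 0) → x = 0)
    (A A' : Submodule k V)
    (hA : A ≤ perp B A) (hA' : A' ≤ perp B A')
    (hdA : finrank k A = t) (hdA' : finrank k A' = t)
    (hgood : IsGood B A A') :
    (∃! ψ : (↥(perp B A) ⧸ A.comap (perp B A).subtype)
        →ₗ[k] (↥(perp B A') ⧸ A'.comap (perp B A').subtype),
      ψ ∘ₗ gammaL B A A' = gammaR B A A') ∧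
    (∀ (ψ : (↥(perp B A) ⧸ A.comap (perp B A).subtype)
          →ₗ[k] (↥(perp B A') ⧸ A'.comap (perp B A').subtype))
       (ψ' : (↥(perp B A') ⧸ A'.comap (perp B A').subtype)
          →ₗ[k] (↥(perp B A) ⧸ A.comap (perp B A).subtype)),
      ψ ∘ₗ gammaL B A A' = gammaR B A A' →
      ψ' ∘ₗ gammaR B A A' = gammaL B A A' →
      Function.Bijective ψ ∧
      (∀ (x y : ↥(perp B A)) (x' y' : ↥(perp B A')),
        ψ (Submodule.Quotient.mk x) = Submodule.Quotient.mk x' →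
        ψ (Submodule.Quotient.mk y) = Submodule.Quotient.mk y' →
        B (x' : V) (y' : V) = B (x : V) (y : V)) ∧
      ψ' ∘ₗ ψ = LinearMap.id) := by
  have hr : LinearMap.IsRefl B := LinearMap.IsAlt.isRefl halt
  obtain ⟨L, ⟨-, h1⟩, ⟨-, h2⟩⟩ := hgood
  have hL1 : L ≤ perp B A := h1 ▸ le_sup_left
  have hL2 : L ≤ perp B A' := h2 ▸ le_sup_left
  have sL : Function.Surjective (gammaL B A A') := by
    intro q
    obtain ⟨⟨x, hx⟩, rfl⟩ := Submodule.Quotient.mk_surjective _ q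
    have hx0 := hx
    rw [← h1] at hx0
    obtain ⟨l, hl, a, ha, rfl⟩ := Submodule.mem_sup.1 hx0
    refine ⟨Submodule.Quotient.mk ⟨l, hL1 hl, hL2 hl⟩, ?_⟩
    refine (Submodule.Quotient.eq _).2 ?_
    change l - (l + a) ∈ A
    simpa using ha
  have sR : Function.Surjective (gammaR B A A') := by
    intro q
    obtain ⟨⟨x, hx⟩, rfl⟩ := Submodule.Quotient.mk_surjective _ q
    have hx0 := hx
    rw [← h2] at hx0
    obtain ⟨l, hl, a, ha, rfl⟩ := Submodule.mem_sup.1 hx0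
    refine ⟨Submodule.Quotient.mk ⟨l, hL1 hl, hL2 hl⟩, ?_⟩
    refine (Submodule.Quotient.eq _).2 ?_
    change l - (l + a) ∈ A'
    simpa using ha
  have iL : Function.Injective (gammaL B A A') := by
    rw [injective_iff_map_eq_zero]
    intro q hq
    obtain ⟨⟨x, hx, hx'⟩, rfl⟩ := Submodule.Quotient.mk_surjective _ q
    have hxA : x ∈ A :=
      (Submodule.Quotient.mk_eq_zero (A.comap (perp B A).subtype) (x := (⟨x, hx⟩ : perp B A))).1 hq
    exact (Submodule.Quotient.mk_eq_zero _).2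
      ⟨hxA, aux_inter B halt hnd A A' L h1 h2 x hxA hx'⟩
  have iR : Function.Injective (gammaR B A A') := by
    rw [injective_iff_map_eq_zero]
    intro q hq
    obtain ⟨⟨x, hx, hx'⟩, rfl⟩ := Submodule.Quotient.mk_surjective _ q
    have hxA : x ∈ A' :=
      (Submodule.Quotient.mk_eq_zero (A'.comap (perp B A').subtype) (x := (⟨x, hx'⟩ : perp B A'))).1 hq
    exact (Submodule.Quotient.mk_eq_zero _).2
      ⟨aux_inter B halt hnd A' A L h2 h1 x hxA hx, hxA⟩
  refine ⟨?_, ?_⟩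
  · let e := LinearEquiv.ofBijective (gammaL B A A') ⟨iL, sL⟩
    refine ⟨gammaR B A A' ∘ₗ e.symm.toLinearMap, ?_, ?_⟩
    · ext1 
      ext x
      exact congrArg (gammaR B A A') (e.symm_apply_apply _)
    · intro ψ hψ
      apply LinearMap.ext
      intro q
      obtain ⟨z, rfl⟩ := sL q
      have := LinearMap.congr_fun hψ z
      refine this.trans ?_
      exact (congrArg (gammaR B A A') (e.symm_apply_apply z)).symm
  · intro ψ ψ' hψ hψ'
    have e1 : ∀ z, ψ (gammaL B A A' z) = gammaR B A A' z := LinearMap.congr_fun hψ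
    have e2 : ∀ z, ψ' (gammaR B A A' z) = gammaL B A A' z := LinearMap.congr_fun hψ'
    refine ⟨⟨?_, ?_⟩, ?_, ?_⟩
    · intro p q h
      obtain ⟨z, rfl⟩ := sL p
      obtain ⟨w, rfl⟩ := sL q
      rw [e1, e1] at h
      rw [iR h]
    · intro q
      obtain ⟨z, rfl⟩ := sR q
      exact ⟨_, e1 z⟩
    · have dec : ∀ (x : ↥(perp B A)) (x' : ↥(perp B A')),
          ψ (Submodule.Quotient.mk x) = Submodule.Quotient.mk x' →
          ∃ l ∈ L, ∃ a ∈ A, ∃ a' ∈ A', (x : V) = l + a ∧ (x' : V) = l + a' := by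
        rintro ⟨x, hx⟩ ⟨x', hx'⟩ h
        have hx0 := hx
        rw [← h1] at hx0
        obtain ⟨l, hl, a, ha, rfl⟩ := Submodule.mem_sup.1 hx0
        have h3 : (Submodule.Quotient.mk ⟨l + a, hx⟩ :
            ↥(perp B A) ⧸ A.comap (perp B A).subtype) =
            gammaL B A A' (Submodule.Quotient.mk ⟨l, hL1 hl, hL2 hl⟩) := by
          refine (Submodule.Quotient.eq _).2 ?_
          change (l + a) - l ∈ A
          simpa using ha
        rw [h3, e1] at h
        have h4 : l - x' ∈ A' :=
          (Submodule.Quotient.eq (A'.comap (perp B A').subtype)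
            (x := ⟨l, hL2 hl⟩) (y := ⟨x', hx'⟩)).1 h
        refine ⟨l, hl, a, ha, x' - l, ?_, rfl, ?_⟩
        · rw [← neg_sub]
          exact A'.neg_mem h4
        · simp
      intro x y x' y' hx hy
      obtain ⟨l, hl, a, ha, a', ha', ex, ex'⟩ := dec x x' hx
      obtain ⟨m, hm, b, hb, b', hb', ey, ey'⟩ := dec y y' hy
      rw [ex, ex', ey, ey']
      simp only [map_add, LinearMap.add_apply]
      rw [hL1 hl b hb, hL2 hl b' hb', hA ha b hb, hA' ha' b' hb',
        hr _ _ (hL1 hm a ha), hr _ _ (hL2 hm a' ha')]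
    · apply LinearMap.ext
      intro q
      obtain ⟨z, rfl⟩ := sL q
      rw [LinearMap.comp_apply, e1, e2, LinearMap.id_apply]
end
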